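/- Let G be an IMM-consistent execution graph such that [R];po;[W] ⊆ ppo ∪ bob⁺ (as guaranteed by the RC11-to-IMM mapping, which places a dependency or a fence between every relaxed read and every subsequent relaxed write). Then po ∪ rf is acyclic; consequently G is RC11-consistent, where RC11-consistency is C11-consistency (codom(rf) = R; co-totality per location; hb_RC11;eco^? irreflexive; rmw ∩ (fr_e;co_e) = ∅; [F^sc];(hb_RC11 ∪ hb_RC11;eco;hb_RC11);[F^sc] acyclic) together with acyclicity of po ∪ rf. -/

import Mathlib

/-! ## Basic definitions: events, labels, relations -/

abbrev Loc := ℕ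
abbrev Val := ℕ

inductive Mode
  | rlx | acq | rel | acqrel | sc
deriving DecidableEq

inductive ExFlag
  | notex | ex
deriving DecidableEq

inductive Strength
  | normal | strong
deriving DecidableEq

inductive Label
  | read (o : Mode) (x : Loc) (v : Val) (s : ExFlag)
  | write (o : Mode) (x : Loc) (v : Val) (st : Strength)
  | fence (o : Mode)
deriving DecidableEq

inductive Event
  | init (x : Loc)
  | ev (tid : ℕ) (sn : ℚ)
deriving DecidableEq

def Event.isInit : Event → Prop
  | .init _ => True
  | .ev _ _ => False

/-- the set of initialization events -/
def InitE : Set Event := {e | e.isInit}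

/-- the `sequenced-before` partial order on events: initialization events precede all
non-initialization events, and events of the same thread are ordered by serial number -/
def evLt : Event → Event → Prop
  | .init _, .ev _ _ => True
  | .ev i n, .ev j m => i = j ∧ n < m
  | _, _ => False

abbrev REv := Event → Event → Prop

/-- relational composition `r ; s` -/
def seqR (r s : REv) : REv := fun a c => ∃ b, r a b ∧ s b c

infixr:70 " ⬝ " => seqR

/-- identity relation on a set: `[A]` -/
def eqv (A : Set Event) : REv := fun a b => a = b ∧ a ∈ A

notation:max "⦗" A "⦘" => eqv A

/-- union of relations -/
def runion (r s : REv) : REv := fun a b => r a b ∨ s a b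

infixl:65 " ∪ᵣ " => runion

/-- reflexive closure `r^?` -/
def rcl (r : REv) : REv := fun a b => a = b ∨ r a b

/-- transitive closure `r⁺` -/
def tcl (r : REv) : REv := Relation.TransGen r

/-- reflexive-transitive closure `r*` -/
def rtcl (r : REv) : REv := Relation.ReflTransGen r

/-- inverse relation `r⁻¹` -/
def transp (r : REv) : REv := fun a b => r b a

def rdom (r : REv) : Set Event := {a | ∃ b, r a b}

def rcodom (r : REv) : Set Event := {b | ∃ a, r a b}

/-- immediate edges: `imm(r) = r ∖ r;r` -/
def immediate (r : REv) : REv := fun a b => r a b ∧ ¬ (r ⬝ r) a b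

def acyclic (r : REv) : Prop := Irreflexive (tcl r)

/-- `r` totally orders `A` -/
def totalOn (A : Set Event) (r : REv) : Prop :=
  ∀ a ∈ A, ∀ b ∈ A, a ≠ b → r a b ∨ r b a

def Label.locOf : Label → Option Loc
  | .read _ x _ _ => some x
  | .write _ x _ _ => some x
  | .fence _ => none

def Label.valOf : Label → Option Val
  | .read _ _ v _ => some v
  | .write _ _ v _ => some v
  | .fence _ => none

/-! ## IMM execution graphs -/

structure Execution where
  E : Set Event
  lab : Event → Label
  rmw : REv
  data : REv
  addr : REv
  ctrl : REv
  casdep : REv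
  rf : REv
  co : REv

namespace Execution

variable (G : Execution)

def loc (e : Event) : Option Loc := (G.lab e).locOf
def valu (e : Event) : Option Val := (G.lab e).valOf

/-- read events -/
def R : Set Event := {e | e ∈ G.E ∧ ∃ o x v s, G.lab e = .read o x v s}
/-- write events -/
def W : Set Event := {e | e ∈ G.E ∧ ∃ o x v st, G.lab e = .write o x v st}
/-- fence events -/
def F : Set Event := {e | e ∈ G.E ∧ ∃ o, G.lab e = .fence o}
/-- acquire reads -/
def Racq : Set Event := {e | e ∈ G.E ∧ ∃ x v s, G.lab e = .read .acq x v s}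
/-- exclusive reads -/
def Rex : Set Event := {e | e ∈ G.E ∧ ∃ o x v, G.lab e = .read o x v .ex}
/-- release writes -/
def Wrel : Set Event := {e | e ∈ G.E ∧ ∃ x v st, G.lab e = .write .rel x v st}
/-- strong writes -/
def Wstrong : Set Event := {e | e ∈ G.E ∧ ∃ o x v, G.lab e = .write o x v .strong}
/-- writes to location `x` -/
def Wloc (x : Loc) : Set Event := {e | e ∈ G.W ∧ G.loc e = some x}
/-- reads from location `x` -/
def Rloc (x : Loc) : Set Event := {e | e ∈ G.R ∧ G.loc e = some x}
/-- SC fences -/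
def Fsc : Set Event := {e | e ∈ G.E ∧ G.lab e = .fence .sc}
/-- fences of mode exactly `rel` -/
def Frel : Set Event := {e | e ∈ G.E ∧ G.lab e = .fence .rel}
/-- fences whose mode is at least `rel` (i.e. `rel`, `acqrel` or `sc`) -/
def FgeRel : Set Event :=
  {e | e ∈ G.E ∧ (G.lab e = .fence .rel ∨ G.lab e = .fence .acqrel ∨ G.lab e = .fence .sc)}
/-- fences whose mode is at least `acq` (i.e. `acq`, `acqrel` or `sc`) -/
def FgeAcq : Set Event :=
  {e | e ∈ G.E ∧ (G.lab e = .fence .acq ∨ G.lab e = .fence .acqrel ∨ G.lab e = .fence .sc)}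

/-- program order -/
def po : REv := fun a b => a ∈ G.E ∧ b ∈ G.E ∧ evLt a b

/-- both events access the same location -/
def sameLoc : REv := fun a b => ∃ x, G.loc a = some x ∧ G.loc b = some x

/-- `po|loc` -/
def poloc : REv := fun a b => G.po a b ∧ G.sameLoc a b

def rfi : REv := fun a b => G.rf a b ∧ G.po a b
def rfe : REv := fun a b => G.rf a b ∧ ¬ G.po a b
def coi : REv := fun a b => G.co a b ∧ G.po a b
def coe : REv := fun a b => G.co a b ∧ ¬ G.po a b

/-- from-read -/
def fr : REv := transp G.rf ⬝ G.co
def fri : REv := fun a b => G.fr a b ∧ G.po a b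
def fre : REv := fun a b => G.fr a b ∧ ¬ G.po a b

/-- release sequence -/
def rs : REv :=
  ⦗G.W⦘ ⬝ G.poloc ⬝ ⦗G.W⦘ ∪ᵣ ⦗G.W⦘ ⬝ rtcl (rcl G.poloc ⬝ G.rf ⬝ G.rmw)

/-- release prefix -/
def release : REv := (⦗G.Wrel⦘ ∪ᵣ ⦗G.FgeRel⦘ ⬝ G.po) ⬝ G.rs

/-- synchronizes with -/
def sw : REv :=
  G.release ⬝ (G.rfi ∪ᵣ rcl G.poloc ⬝ G.rfe) ⬝ (⦗G.Racq⦘ ∪ᵣ G.po ⬝ ⦗G.FgeAcq⦘)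

/-- happens-before -/
def hb : REv := tcl (G.po ∪ᵣ G.sw)

/-- extended coherence order -/
def eco : REv := G.rf ∪ᵣ G.co ⬝ rcl G.rf ∪ᵣ G.fr ⬝ rcl G.rf

/-- barrier order -/
def bob : REv :=
  G.po ⬝ ⦗G.Wrel⦘ ∪ᵣ ⦗G.Racq⦘ ⬝ G.po ∪ᵣ G.po ⬝ ⦗G.F⦘ ∪ᵣ ⦗G.F⦘ ⬝ G.po ∪ᵣ
    ⦗G.Wrel⦘ ⬝ G.poloc ⬝ ⦗G.W⦘

/-- syntactic dependencies -/
def deps : REv :=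
  G.data ∪ᵣ G.ctrl ∪ᵣ G.addr ⬝ rcl G.po ∪ᵣ G.casdep ∪ᵣ ⦗G.Rex⦘ ⬝ G.po

/-- preserved program order -/
def ppo : REv := ⦗G.R⦘ ⬝ tcl (G.deps ∪ᵣ G.rfi) ⬝ ⦗G.W⦘

def detour : REv := fun a b => (G.coe ⬝ G.rfe) a b ∧ G.po a b

/-- partial SC fence order -/
def psc : REv := ⦗G.Fsc⦘ ⬝ G.hb ⬝ G.eco ⬝ G.hb ⬝ ⦗G.Fsc⦘

/-- the acyclicity relation of IMM -/
def ar : REv :=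
  G.rfe ∪ᵣ G.bob ∪ᵣ G.ppo ∪ᵣ G.detour ∪ᵣ G.psc ∪ᵣ ⦗G.Wstrong⦘ ⬝ G.po ⬝ ⦗G.W⦘

/-! RC11-style variants -/

def rsRC11 : REv := ⦗G.W⦘ ⬝ rcl G.poloc ⬝ rtcl (G.rf ⬝ G.rmw)

def releaseRC11 : REv := (⦗G.Wrel⦘ ∪ᵣ ⦗G.FgeRel⦘ ⬝ G.po) ⬝ G.rsRC11

def swRC11 : REv := G.releaseRC11 ⬝ G.rf ⬝ (⦗G.Racq⦘ ∪ᵣ G.po ⬝ ⦗G.FgeAcq⦘)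

def hbRC11 : REv := tcl (G.po ∪ᵣ G.swRC11)

end Execution

/-- Well-formedness of an IMM execution graph -/
structure ExecWf (G : Execution) : Prop where
  finE : G.E.Finite
  init_lab : ∀ x, Event.init x ∈ G.E →
    G.lab (Event.init x) = Label.write .rlx x 0 .normal
  read_mode : ∀ e ∈ G.E, ∀ o x v s, G.lab e = .read o x v s → o = Mode.rlx ∨ o = Mode.acq
  write_mode : ∀ e ∈ G.E, ∀ o x v st, G.lab e = .write o x v st → o = Mode.rlx ∨ o = Mode.rel
  fence_mode : ∀ e ∈ G.E, ∀ o, G.lab e = .fence o →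
    o = Mode.acq ∨ o = Mode.rel ∨ o = Mode.acqrel ∨ o = Mode.sc
  rmw_sub : ∀ a b, G.rmw a b → a ∈ G.Rex ∧ b ∈ G.W ∧ G.sameLoc a b ∧ immediate G.po a b
  strong_rmw : G.Wstrong ⊆ rcodom G.rmw
  data_sub : ∀ a b, G.data a b → a ∈ G.R ∧ G.po a b ∧ b ∈ G.W
  addr_sub : ∀ a b, G.addr a b → a ∈ G.R ∧ G.po a b ∧ (b ∈ G.R ∨ b ∈ G.W)
  ctrl_sub : ∀ a b, G.ctrl a b → a ∈ G.R ∧ G.po a b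
  ctrl_po : ∀ a b c, G.ctrl a b → G.po b c → G.ctrl a c
  casdep_sub : ∀ a b, G.casdep a b → a ∈ G.R ∧ G.po a b ∧ b ∈ G.Rex
  rf_sub : ∀ a b, G.rf a b → a ∈ G.W ∧ b ∈ G.R ∧ G.sameLoc a b
  rf_val : ∀ a b, G.rf a b → G.valu a = G.valu b
  rf_func : ∀ a b c, G.rf a c → G.rf b c → a = b
  co_sub : ∀ a b, G.co a b → a ∈ G.W ∧ b ∈ G.W ∧ G.sameLoc a b
  co_trans : Transitive G.co
  co_irr : Irreflexive G.co

/-- IMM-consistency (Definition 3.1) -/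
def IMMConsistent (G : Execution) : Prop :=
  rcodom G.rf = G.R ∧
  (∀ x, totalOn (G.Wloc x) G.co) ∧
  Irreflexive (G.hb ⬝ rcl G.eco) ∧
  (∀ a b, G.rmw a b → ¬ (G.fre ⬝ G.coe) a b) ∧
  acyclic G.ar

/-- C11-consistency (for the fragment without non-atomic and SC accesses). -/
def C11Consistent (G : Execution) : Prop :=
  rcodom G.rf = G.R ∧
  (∀ x, totalOn (G.Wloc x) G.co) ∧
  Irreflexive (G.hbRC11 ⬝ rcl G.eco) ∧
  (∀ a b, G.rmw a b → ¬ (G.fre ⬝ G.coe) a b) ∧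
  acyclic (⦗G.Fsc⦘ ⬝ (G.hbRC11 ∪ᵣ G.hbRC11 ⬝ G.eco ⬝ G.hbRC11) ⬝ ⦗G.Fsc⦘)

/-- RC11-consistency: C11-consistency together with acyclicity of `po ∪ rf`. -/
def RC11Consistent (G : Execution) : Prop :=
  C11Consistent G ∧ acyclic (G.po ∪ᵣ G.rf)

theorem tcl_mono {r s : REv} (h : ∀ a b, r a b → s a b) {a b : Event} (hab : tcl r a b) :
    tcl s a b :=
  Relation.TransGen.mono h a b hab

theorem rtcl_mono {r s : REv} (h : ∀ a b, r a b → s a b) {a b : Event} (hab : rtcl r a b) :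
    rtcl s a b :=
  Relation.ReflTransGen.mono h a b hab

namespace Execution

variable {G : Execution}

theorem po_trans {a b c : Event} (hab : G.po a b) (hbc : G.po b c) : G.po a c := by
  refine ⟨hab.1, hbc.2.1, ?_⟩
  have h₁ := hab.2.2
  have h₂ := hbc.2.2
  cases a <;> cases b <;> cases c <;> simp only [evLt] at h₁ h₂ ⊢
  exact ⟨h₁.1.trans h₂.1, h₁.2.trans h₂.2⟩

theorem po_irrefl (a : Event) : ¬ G.po a a := by
  intro h
  have h' := h.2.2
  cases a <;> simp [evLt] at h'

theorem rcl_po_trans {a b c : Event} (hab : rcl G.po a b) (hbc : G.po b c) : G.po a c := by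
  rcases hab with rfl | hab
  · exact hbc
  · exact po_trans hab hbc

theorem rcl_po_trans_rcl {a b c : Event} (hab : rcl G.po a b) (hbc : rcl G.po b c) :
    rcl G.po a c := by
  rcases hbc with rfl | hbc
  · exact hab
  · exact Or.inr (rcl_po_trans hab hbc)

theorem ne_of_mem_R_of_mem_W {a b : Event} (ha : a ∈ G.R) (hb : b ∈ G.W) : a ≠ b := by
  rintro rfl
  obtain ⟨-, o, x, v, s, h⟩ := ha
  obtain ⟨-, o', x', v', s', h'⟩ := hb
  simp [h] at h'

theorem rfe_sub_ar {a b : Event} (h : G.rfe a b) : G.ar a b :=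
  Or.inl (Or.inl (Or.inl (Or.inl (Or.inl h))))

theorem bob_sub_ar {a b : Event} (h : G.bob a b) : G.ar a b :=
  Or.inl (Or.inl (Or.inl (Or.inl (Or.inr h))))

theorem ppo_sub_ar {a b : Event} (h : G.ppo a b) : G.ar a b :=
  Or.inl (Or.inl (Or.inl (Or.inr h)))

theorem psc_sub_ar {a b : Event} (h : G.psc a b) : G.ar a b :=
  Or.inl (Or.inr h)

/-- Program order from a read to a write is contained in `ar⁺`. -/
theorem tcl_ar_of_rcl_po
    (hdep : ∀ a b, a ∈ G.R → G.po a b → b ∈ G.W → G.ppo a b ∨ tcl G.bob a b)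
    {r w : Event} (hr : r ∈ G.R) (h : rcl G.po r w) (hw : w ∈ G.W) : tcl G.ar r w := by
  rcases h with h | h
  · exact absurd h (ne_of_mem_R_of_mem_W hr hw)
  · rcases hdep r w hr h hw with h | h
    · exact .single (ppo_sub_ar h)
    · exact tcl_mono (fun _ _ => bob_sub_ar) h

/-- Every `po ∪ rf` path is a `po` edge or contains an `ar` path from a write to a read,
surrounded by `po` edges. -/
theorem tcl_po_rf_cases (hwf : ExecWf G)
    (hdep : ∀ a b, a ∈ G.R → G.po a b → b ∈ G.W → G.ppo a b ∨ tcl G.bob a b)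
    {a b : Event} (h : tcl (G.po ∪ᵣ G.rf) a b) :
    G.po a b ∨
      ∃ w ∈ G.W, ∃ r ∈ G.R, rcl G.po a w ∧ tcl G.ar w r ∧ rcl G.po r b := by
  have step : ∀ {b c}, (G.po ∪ᵣ G.rf) b c → G.po b c ∨ G.rfe b c := by
    rintro b c (h | h)
    · exact Or.inl h
    · by_cases hp : G.po b c
      · exact Or.inl hp
      · exact Or.inr ⟨h, hp⟩
  induction h with
  | single h =>
    rcases step h with h | h
    · exact Or.inl h
    · obtain ⟨hw, hr, -⟩ := hwf.rf_sub _ _ h.1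
      exact Or.inr ⟨_, hw, _, hr, Or.inl rfl, .single (rfe_sub_ar h), Or.inl rfl⟩
  | tail _ h ih =>
    rcases step h with h | h
    · rcases ih with ih | ⟨w, hw, r, hr, haw, hwr, hrb⟩
      · exact Or.inl (po_trans ih h)
      · exact Or.inr ⟨w, hw, r, hr, haw, hwr, Or.inr (rcl_po_trans hrb h)⟩
    · obtain ⟨hb, hc, -⟩ := hwf.rf_sub _ _ h.1
      rcases ih with ih | ⟨w, hw, r, hr, haw, hwr, hrb⟩
      · exact Or.inr ⟨_, hb, _, hc, Or.inr ih, .single (rfe_sub_ar h), Or.inl rfl⟩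
      · exact Or.inr ⟨w, hw, _, hc, haw,
          (hwr.trans (tcl_ar_of_rcl_po hdep hr hrb hb)).tail (rfe_sub_ar h), Or.inl rfl⟩

theorem acyclic_po_rf (hwf : ExecWf G) (har : acyclic G.ar)
    (hdep : ∀ a b, a ∈ G.R → G.po a b → b ∈ G.W → G.ppo a b ∨ tcl G.bob a b) :
    acyclic (G.po ∪ᵣ G.rf) := by
  intro a h
  rcases tcl_po_rf_cases hwf hdep h with h | ⟨w, hw, r, hr, haw, hwr, hra⟩
  · exact po_irrefl a h
  · exact har w (hwr.trans (tcl_ar_of_rcl_po hdep hr (rcl_po_trans_rcl hra haw) hw))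

theorem rsRC11_sub_rs {a b : Event} (h : G.rsRC11 a b) (hb : b ∈ G.W) : G.rs a b := by
  have mono : ∀ {c d}, rtcl (G.rf ⬝ G.rmw) c d → rtcl (rcl G.poloc ⬝ G.rf ⬝ G.rmw) c d :=
    fun h => rtcl_mono (fun _ _ h => ⟨_, Or.inl rfl, h⟩) h
  obtain ⟨_, ⟨rfl, ha⟩, c, hac, hcb⟩ := h
  rcases hac with rfl | hac
  · exact Or.inr ⟨_, ⟨rfl, ha⟩, mono hcb⟩
  · rcases Relation.ReflTransGen.cases_head hcb with rfl | ⟨d, hcd, hdb⟩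
    · exact Or.inl ⟨_, ⟨rfl, ha⟩, _, hac, rfl, hb⟩
    · exact Or.inr ⟨_, ⟨rfl, ha⟩, .head ⟨_, Or.inr hac, hcd⟩ (mono hdb)⟩

theorem swRC11_sub_sw (hwf : ExecWf G) {a b : Event} (h : G.swRC11 a b) : G.sw a b := by
  obtain ⟨w, ⟨c, hac, hcw⟩, r, hwr, hrb⟩ := h
  refine ⟨w, ⟨c, hac, rsRC11_sub_rs hcw (hwf.rf_sub _ _ hwr).1⟩, r, ?_, hrb⟩
  by_cases hp : G.po w r
  · exact Or.inl ⟨hwr, hp⟩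
  · exact Or.inr ⟨w, Or.inl rfl, hwr, hp⟩

theorem hbRC11_sub_hb (hwf : ExecWf G) {a b : Event} (h : G.hbRC11 a b) : G.hb a b :=
  tcl_mono (fun _ _ h => h.imp id (swRC11_sub_sw hwf)) h

theorem hb_psc_sub_psc {a b c : Event} (ha : a ∈ G.Fsc) (hab : G.hb a b) (hbc : G.psc b c) :
    G.psc a c := by
  obtain ⟨_, ⟨rfl, -⟩, d, hbd, hdc⟩ := hbc
  exact ⟨a, ⟨rfl, ha⟩, d, hab.trans hbd, hdc⟩

theorem psc_hb_sub_psc {a b c : Event} (hab : G.psc a b) (hbc : G.hb b c) (hc : c ∈ G.Fsc) :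
    G.psc a c := by
  obtain ⟨_, ha, d, had, e, hde, f, hef, rfl, -⟩ := hab
  exact ⟨_, ha, d, had, e, hde, c, hef.trans hbc, rfl, hc⟩

theorem tcl_psc_hb_sub_tcl_psc {a b c : Event} (hab : tcl G.psc a b) (hbc : G.hb b c)
    (hc : c ∈ G.Fsc) : tcl G.psc a c := by
  rcases hab with h | ⟨h, h'⟩
  · exact .single (psc_hb_sub_psc h hbc hc)
  · exact .tail h (psc_hb_sub_psc h' hbc hc)

/-- Between SC fences, `hb` edges are absorbed by the `psc` edges of a path. -/
theorem acyclic_psc_hb (hhb : Irreflexive G.hb) (har : acyclic G.ar) :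
    acyclic (⦗G.Fsc⦘ ⬝ (G.hb ∪ᵣ G.hb ⬝ G.eco ⬝ G.hb) ⬝ ⦗G.Fsc⦘) := by
  have step : ∀ {a b}, (⦗G.Fsc⦘ ⬝ (G.hb ∪ᵣ G.hb ⬝ G.eco ⬝ G.hb) ⬝ ⦗G.Fsc⦘) a b →
      (a ∈ G.Fsc ∧ G.hb a b ∧ b ∈ G.Fsc) ∨ G.psc a b := by
    rintro a b ⟨_, ⟨rfl, ha⟩, _, h | ⟨c, hac, d, hcd, hdb⟩, rfl, hb⟩
    · exact Or.inl ⟨ha, h, hb⟩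
    · exact Or.inr ⟨_, ⟨rfl, ha⟩, c, hac, d, hcd, _, hdb, rfl, hb⟩
  have path : ∀ {a b}, tcl (⦗G.Fsc⦘ ⬝ (G.hb ∪ᵣ G.hb ⬝ G.eco ⬝ G.hb) ⬝ ⦗G.Fsc⦘) a b →
      (a ∈ G.Fsc ∧ G.hb a b) ∨ tcl G.psc a b := by
    intro a b h
    induction h with
    | single h => exact (step h).imp (fun h => ⟨h.1, h.2.1⟩) .single
    | tail _ h ih =>
      rcases ih, step h with ⟨⟨ha, hab⟩ | hab, ⟨-, hbc, hc⟩ | hbc⟩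
      · exact Or.inl ⟨ha, hab.trans hbc⟩
      · exact Or.inr (.single (hb_psc_sub_psc ha hab hbc))
      · exact Or.inr (tcl_psc_hb_sub_tcl_psc hab hbc hc)
      · exact Or.inr (hab.tail hbc)
  intro a h
  rcases path h with h | h
  · exact hhb a h.2
  · exact har a (tcl_mono (fun _ _ => psc_sub_ar) h)

end Execution

/-- if `G` is IMM-consistent and `[R];po;[W] ⊆ ppo ∪ bob⁺`
(as guaranteed by the RC11-to-IMM mapping), then `po ∪ rf` is acyclic;
consequently `G` is RC11-consistent. -/
theorem imm_consistent_implies_rc11_consistent (G : Execution) (hwf : ExecWf G)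
    (hcons : IMMConsistent G)
    (hdep : ∀ a b, a ∈ G.R → G.po a b → b ∈ G.W → G.ppo a b ∨ tcl G.bob a b) :
    acyclic (G.po ∪ᵣ G.rf) ∧ RC11Consistent G := by
  obtain ⟨hrf, hco, hcoh, hat, har⟩ := hcons
  have hpo := Execution.acyclic_po_rf hwf har hdep
  refine ⟨hpo, ⟨hrf, hco, ?_, hat, ?_⟩, hpo⟩
  · rintro a ⟨b, hab, hba⟩
    exact hcoh a ⟨b, Execution.hbRC11_sub_hb hwf hab, hba⟩
  · have hhb : Irreflexive G.hb := fun a h => hcoh a ⟨a, h, Or.inl rfl⟩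
    intro a h
    refine Execution.acyclic_psc_hb hhb har a (tcl_mono ?_ h)
    rintro a b ⟨c, hac, d, hcd, hdb⟩
    refine ⟨c, hac, d, ?_, hdb⟩
    rcases hcd with h | ⟨e, hce, f, hef, hfd⟩
    · exact Or.inl (Execution.hbRC11_sub_hb hwf h)
    · exact Or.inr ⟨e, Execution.hbRC11_sub_hb hwf hce, f, hef, Execution.hbRC11_sub_hb hwf hfd⟩
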